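/- For convex bodies K, L ⊂ ℝ² and x, y ≥ 0, the area of the Minkowski sum satisfies vol₂(xK + yL) = vol₂(K)x² + 2v(K,L)xy + vol₂(L)y², where v(K,L) = (vol₂(K+L) - vol₂(K) - vol₂(L))/2; i.e., the function t ↦ vol₂(tK + (1-t)L) agrees with the quadratic polynomial determined by its values at t = 0, 1/2, 1. -/

import Mathlib

open Pointwise MeasureTheory

/-- Top of the vertical fiber. -/
noncomputable def topF (M : Set (ℝ × ℝ)) (u : ℝ) : ℝ := sSup {v | (u, v) ∈ M}

/-- Vertical reflection. -/
def reflV (M : Set (ℝ × ℝ)) : Set (ℝ × ℝ) := {z | (z.1, -z.2) ∈ M}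

lemma fiber_compact {M : Set (ℝ × ℝ)} (hM : IsCompact M) (u : ℝ) :
    IsCompact {v | (u, v) ∈ M} := by
  have h : {v | (u, v) ∈ M} = Prod.snd '' (M ∩ (Prod.fst ⁻¹' {u})) := by
    ext v
    constructor
    · intro hv
      exact ⟨(u, v), ⟨hv, rfl⟩, rfl⟩
    · rintro ⟨⟨a, b⟩, ⟨h1, h2⟩, h3⟩
      simp only [Set.mem_preimage, Set.mem_singleton_iff] at h2 h3
      subst h2 h3
      exact h1
  rw [h]
  exact (hM.inter_right (isClosed_singleton.preimage continuous_fst)).image continuous_snd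

lemma topF_mem {M : Set (ℝ × ℝ)} (hM : IsCompact M) {u : ℝ} (hu : u ∈ Prod.fst '' M) :
    (u, topF M u) ∈ M := by
  obtain ⟨⟨a, b⟩, h, rfl⟩ := hu
  exact (fiber_compact hM a).sSup_mem ⟨b, h⟩

lemma le_topF {M : Set (ℝ × ℝ)} (hM : IsCompact M) {u v : ℝ} (hu : (u, v) ∈ M) :
    v ≤ topF M u := le_csSup (fiber_compact hM u).bddAbove hu

lemma topF_eq {M : Set (ℝ × ℝ)} (hM : IsCompact M) {u v : ℝ} (hu : (u, v) ∈ M)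
    (h : ∀ w, (u, w) ∈ M → w ≤ v) : topF M u = v :=
  le_antisymm (h _ (topF_mem hM ⟨_, hu, rfl⟩)) (le_topF hM hu)

lemma topF_measurable {M : Set (ℝ × ℝ)} (hM : IsCompact M) : Measurable (topF M) := by
  apply measurable_of_Ici
  intro c
  have h : topF M ⁻¹' Set.Ici c = (Prod.fst '' (M ∩ Prod.snd ⁻¹' Set.Ici c)) ∪
      ((Prod.fst '' M)ᶜ ∩ {_u | c ≤ 0}) := by
    ext u
    by_cases hu : u ∈ Prod.fst '' M
    · simp only [Set.mem_preimage, Set.mem_Ici, Set.mem_union, Set.mem_inter_iff,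
        Set.mem_compl_iff, hu, not_true, false_and, or_false]
      constructor
      · intro h
        exact ⟨(u, topF M u), ⟨topF_mem hM hu, h⟩, rfl⟩
      · rintro ⟨⟨a, b⟩, ⟨h1, h2⟩, rfl⟩
        exact le_trans h2 (le_topF hM h1)
    · have h0 : topF M u = 0 := by
        have : {v | (u, v) ∈ M} = ∅ := by
          ext v
          simp only [Set.mem_ofPred_eq, Set.mem_empty_iff_false, iff_false]
          exact fun h => hu ⟨_, h, rfl⟩
        rw [topF, this, Real.sSup_empty]
      have h1 : u ∉ Prod.fst '' (M ∩ Prod.snd ⁻¹' Set.Ici c) :=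
        fun h => hu (Set.image_mono Set.inter_subset_left h)
      simp only [Set.mem_preimage, Set.mem_Ici, Set.mem_union, Set.mem_inter_iff,
        Set.mem_compl_iff, hu, h0, h1, not_false_eq_true, true_and, false_or, Set.mem_ofPred_eq]
  rw [h]
  refine MeasurableSet.union ?_ (MeasurableSet.inter ?_ (MeasurableSet.const _))
  · exact ((hM.inter_right (isClosed_Ici.preimage continuous_snd)).image
      continuous_fst).measurableSet
  · exact (hM.image continuous_fst).measurableSet.compl

lemma topF_integrable {M : Set (ℝ × ℝ)} (hM : IsCompact M) :
    IntegrableOn (topF M) (Prod.fst '' M) := by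
  obtain ⟨R, hR⟩ := hM.isBounded.exists_norm_le
  have hP := hM.image continuous_fst
  refine Measure.integrableOn_of_bounded (M := R) hP.measure_lt_top.ne
    (topF_measurable hM).aestronglyMeasurable ?_
  refine (ae_restrict_iff' hP.measurableSet).2 (Filter.Eventually.of_forall fun u hu => ?_)
  exact le_trans (norm_snd_le (u, topF M u)) (hR _ (topF_mem hM hu))

lemma reflV_compact {M : Set (ℝ × ℝ)} (hM : IsCompact M) : IsCompact (reflV M) := by
  have : reflV M = (fun z : ℝ × ℝ => (z.1, -z.2)) '' M := by
    ext z
    constructor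
    · intro h; exact ⟨_, h, by simp⟩
    · rintro ⟨w, hw, rfl⟩; simpa [reflV] using hw
  rw [this]
  exact hM.image (by fun_prop)

lemma reflV_convex {M : Set (ℝ × ℝ)} (hM : Convex ℝ M) : Convex ℝ (reflV M) := by
  intro a ha b hb s t hs ht hst
  have := hM ha hb hs ht hst
  simp only [reflV, Set.mem_ofPred_eq]
  convert this using 1
  ext <;> simp
  ring

lemma reflV_fst (M : Set (ℝ × ℝ)) : Prod.fst '' reflV M = Prod.fst '' M := by
  ext u
  constructor
  · rintro ⟨z, hz, rfl⟩; exact ⟨_, hz, rfl⟩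
  · rintro ⟨z, hz, rfl⟩; exact ⟨(z.1, -z.2), by simpa [reflV] using hz, rfl⟩

lemma reflV_comb (K L : Set (ℝ × ℝ)) (x y : ℝ) :
    reflV (x • K + y • L) = x • reflV K + y • reflV L := by
  ext z
  constructor
  · rintro ⟨_, ⟨k, hk, rfl⟩, _, ⟨l, hl, rfl⟩, h⟩
    refine ⟨_, ⟨(k.1, -k.2), by simpa [reflV] using hk, rfl⟩, _,
      ⟨(l.1, -l.2), by simpa [reflV] using hl, rfl⟩, ?_⟩
    have h1 := congrArg Prod.fst h
    have h2 := congrArg Prod.snd h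
    ext <;> simp at h1 h2 ⊢ <;> linarith
  · rintro ⟨_, ⟨k, hk, rfl⟩, _, ⟨l, hl, rfl⟩, h⟩
    refine ⟨_, ⟨(k.1, -k.2), hk, rfl⟩, _, ⟨(l.1, -l.2), hl, rfl⟩, ?_⟩
    have h1 := congrArg Prod.fst h
    have h2 := congrArg Prod.snd h
    ext <;> simp at h1 h2 ⊢ <;> linarith

lemma vol_eq {M : Set (ℝ × ℝ)} (hM : IsCompact M) (hc : Convex ℝ M) :
    (volume M).toReal = (∫ u in Prod.fst '' M, topF M u) +
      ∫ u in Prod.fst '' (reflV M), topF (reflV M) u := by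
  have hP := hM.image continuous_fst
  have hI1 := topF_integrable hM
  have hI2 := topF_integrable (reflV_compact hM)
  rw [reflV_fst] at hI2 ⊢
  rw [← integral_add hI1 hI2]
  have hfib : ∀ u ∈ Prod.fst '' M,
      Prod.mk u ⁻¹' M = Set.Icc (-topF (reflV M) u) (topF M u) := by
    intro u hu
    have h2 : (u, -topF (reflV M) u) ∈ M :=
      topF_mem (reflV_compact hM) (by rwa [reflV_fst])
    have h1 := topF_mem hM hu
    ext v
    constructor
    · intro hv
      refine ⟨?_, le_topF hM hv⟩
      have : (u, -v) ∈ reflV M := by simpa [reflV] using hv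
      linarith [le_topF (reflV_compact hM) this]
    · intro hv
      have hcf : Convex ℝ (Prod.mk u ⁻¹' M) := by
        intro a ha b hb s t hs ht hst
        have := hc ha hb hs ht hst
        simp only [Set.mem_preimage]
        convert this using 1
        ext
        · simp; rw [← add_mul, hst, one_mul]
        · simp
      exact hcf.ordConnected.out h2 h1 hv
  have hne : ∀ u ∈ Prod.fst '' M, 0 ≤ topF M u + topF (reflV M) u := by
    intro u hu
    obtain ⟨⟨a, b⟩, h, rfl⟩ := hu
    have : b ∈ Prod.mk a ⁻¹' M := h
    rw [hfib a ⟨_, h, rfl⟩] at this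
    linarith [this.1, this.2]
  rw [integral_eq_lintegral_of_nonneg_ae
    ((ae_restrict_iff' hP.measurableSet).2 (Filter.Eventually.of_forall hne))
    ((topF_measurable hM).add (topF_measurable (reflV_compact hM))).aestronglyMeasurable]
  congr 1
  rw [Measure.volume_eq_prod, Measure.prod_apply hM.measurableSet,
    ← lintegral_indicator hP.measurableSet]
  congr 1
  ext u
  by_cases hu : u ∈ Prod.fst '' M
  · rw [Set.indicator_of_mem hu, hfib u hu, Real.volume_Icc, sub_neg_eq_add]
  · rw [Set.indicator_of_notMem hu]
    have : Prod.mk u ⁻¹' M = ∅ := by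
      ext v
      simp only [Set.mem_preimage, Set.mem_empty_iff_false, iff_false]
      exact fun h => hu ⟨_, h, rfl⟩
    rw [this, measure_empty]

/-- Optimal pairs over τ. -/
def OptP (K L : Set (ℝ × ℝ)) (τ : ℝ) (p q : ℝ × ℝ) : Prop :=
  p ∈ K ∧ q ∈ L ∧ p.1 + q.1 = τ ∧
    ∀ p' ∈ K, ∀ q' ∈ L, p'.1 + q'.1 = τ → p'.2 + q'.2 ≤ p.2 + q.2

lemma exists_opt {K L : Set (ℝ × ℝ)} (hK : IsCompact K) (hL : IsCompact L) {τ : ℝ}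
    (hτ : ∃ p ∈ K, ∃ q ∈ L, p.1 + q.1 = τ) :
    ∃ p q, OptP K L τ p q ∧ ∀ p' q', OptP K L τ p' q' → p.1 ≤ p'.1 := by
  set S : Set ((ℝ × ℝ) × (ℝ × ℝ)) := (K ×ˢ L) ∩ {z | z.1.1 + z.2.1 = τ} with hS
  have hSc : IsCompact S := (hK.prod hL).inter_right (isClosed_eq (by fun_prop) (by fun_prop))
  have hSn : S.Nonempty := by
    obtain ⟨p, hp, q, hq, h⟩ := hτ
    exact ⟨(p, q), ⟨hp, hq⟩, h⟩
  obtain ⟨z, hz, hzm⟩ := hSc.exists_isMaxOn hSn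
    (f := fun z : (ℝ × ℝ) × (ℝ × ℝ) => z.1.2 + z.2.2) (by fun_prop)
  have hTc : IsCompact (S ∩ {w | z.1.2 + z.2.2 ≤ w.1.2 + w.2.2}) :=
    hSc.inter_right (isClosed_le (by fun_prop) (by fun_prop))
  obtain ⟨w, hw, hwm⟩ := hTc.exists_isMinOn ⟨z, hz, le_refl (z.1.2 + z.2.2)⟩
    (f := fun z : (ℝ × ℝ) × (ℝ × ℝ) => z.1.1) (by fun_prop)
  refine ⟨w.1, w.2, ⟨hw.1.1.1, hw.1.1.2, hw.1.2, ?_⟩, ?_⟩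
  · intro p' hp' q' hq' h
    exact le_trans (hzm (show (p', q') ∈ S from ⟨⟨hp', hq'⟩, h⟩)) hw.2
  · rintro p' q' ⟨h1, h2, h3, h4⟩
    exact hwm (show (p', q') ∈ _ from ⟨⟨⟨h1, h2⟩, h3⟩, h4 _ hz.1.1 _ hz.1.2 hz.2⟩)

/-- Exchange: two points of a convex set, intermediate abscissae. -/
lemma exch {L : Set (ℝ × ℝ)} (hL : Convex ℝ L) {q q' : ℝ × ℝ} (hq : q ∈ L) (hq' : q' ∈ L)
    {m : ℝ} (h1 : q.1 < m) (h2 : m < q'.1) :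
    ∃ a ∈ L, ∃ b ∈ L, a.1 = m ∧ b.1 = q.1 + q'.1 - m ∧ a.2 + b.2 = q.2 + q'.2 := by
  have hd : 0 < q'.1 - q.1 := by linarith
  set l := (m - q.1) / (q'.1 - q.1) with hl
  have hlm : l * (q'.1 - q.1) = m - q.1 := div_mul_cancel₀ _ hd.ne'
  have hl0 : 0 ≤ l := div_nonneg (by linarith) hd.le
  have hl1 : l ≤ 1 := (div_le_one hd).2 (by linarith)
  refine ⟨_, hL hq hq' (sub_nonneg.2 hl1) hl0 (by ring), _,
    hL hq hq' hl0 (sub_nonneg.2 hl1) (by ring), ?_, ?_, ?_⟩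
  · simp; linarith
  · simp; linarith
  · simp; ring

lemma opt_mono {K L : Set (ℝ × ℝ)} (hK : Convex ℝ K) (hL : Convex ℝ L) {τ τ' : ℝ} (h : τ < τ')
    {p q p' q' : ℝ × ℝ} (ho : OptP K L τ p q) (hm : ∀ a b, OptP K L τ a b → p.1 ≤ a.1)
    (ho' : OptP K L τ' p' q') (hm' : ∀ a b, OptP K L τ' a b → p'.1 ≤ a.1) :
    p.1 ≤ p'.1 ∧ q.1 ≤ q'.1 := by
  obtain ⟨hp, hq, hs, hmax⟩ := ho
  obtain ⟨hp', hq', hs', hmax'⟩ := ho'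
  constructor
  · by_contra! hlt
    obtain ⟨a, ha, b, hb, h1, h2, h3⟩ := exch hL hq hq' (m := τ - p'.1) (by linarith)
      (by linarith)
    have e1 := hmax p' hp' a ha (by linarith)
    have e2 := hmax' p hp b hb (by linarith)
    have := hm p' a ⟨hp', ha, by linarith, fun c hc d hd hcd => by
      linarith [hmax c hc d hd hcd]⟩
    linarith
  · by_contra! hlt
    obtain ⟨a, ha, b, hb, h1, h2, h3⟩ := exch hK hp hp' (m := τ - q'.1) (by linarith)
      (by linarith)
    have e1 := hmax a ha q' hq' (by linarith)
    have e2 := hmax' b hb q hq (by linarith)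
    have := hm' b q ⟨hb, hq, by linarith, fun c hc d hd hcd => by
      linarith [hmax' c hc d hd hcd]⟩
    linarith

lemma opt_scale {K L : Set (ℝ × ℝ)} (hK : Convex ℝ K) (hL : Convex ℝ L) {τ : ℝ}
    {p q : ℝ × ℝ} (ho : OptP K L τ p q) {x y : ℝ} (hx : 0 ≤ x) (hy : 0 ≤ y)
    {p' q' : ℝ × ℝ} (hp' : p' ∈ K) (hq' : q' ∈ L)
    (h : x * p'.1 + y * q'.1 = x * p.1 + y * q.1) :
    x * p'.2 + y * q'.2 ≤ x * p.2 + y * q.2 := by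
  obtain ⟨hp, hq, hs, hmax⟩ := ho
  set e := 1 / (x + y + 1) with he
  have he0 : 0 < e := by positivity
  have hee : e * (x + y + 1) = 1 := by rw [he]; field_simp
  have hex : 0 ≤ e * x := by positivity
  have hey : 0 ≤ e * y := by positivity
  have ha := hK hp hp' (a := 1 - e * x) (b := e * x) (by nlinarith) hex (by ring)
  have hb := hL hq hq' (a := 1 - e * y) (b := e * y) (by nlinarith) hey (by ring)
  have := hmax _ ha _ hb (by simp; linear_combination hs + e * h)
  simp at this
  have h2 : e * (x * p'.2 + y * q'.2) ≤ e * (x * p.2 + y * q.2) := by linarith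
  exact le_of_mul_le_mul_left h2 he0

lemma comb_compact {K L : Set (ℝ × ℝ)} (hK : IsCompact K) (hL : IsCompact L) (x y : ℝ) :
    IsCompact (x • K + y • L) := (hK.smul x).add (hL.smul y)

lemma exists_param {K L : Set (ℝ × ℝ)}
    (hKn : K.Nonempty) (hK : IsCompact K) (hKc : Convex ℝ K)
    (hLn : L.Nonempty) (hL : IsCompact L) (hLc : Convex ℝ L) :
    ∃ (α β : ℝ) (P Q : ℝ → ℝ × ℝ), α ≤ β ∧ (∀ τ, ∃ τ', OptP K L τ' (P τ) (Q τ)) ∧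
      Monotone (fun τ => (P τ).1) ∧ Monotone (fun τ => (Q τ).1) ∧
      LipschitzWith 1 (fun τ => (P τ).1) ∧ LipschitzWith 1 (fun τ => (Q τ).1) ∧
      (∀ p ∈ K, (P α).1 ≤ p.1 ∧ p.1 ≤ (P β).1) ∧ (∀ q ∈ L, (Q α).1 ≤ q.1 ∧ q.1 ≤ (Q β).1) := by
  obtain ⟨pa, hpa, hpa'⟩ := hK.exists_isMinOn hKn (f := Prod.fst) (by fun_prop)
  obtain ⟨pb, hpb, hpb'⟩ := hK.exists_isMaxOn hKn (f := Prod.fst) (by fun_prop)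
  obtain ⟨qa, hqa, hqa'⟩ := hL.exists_isMinOn hLn (f := Prod.fst) (by fun_prop)
  obtain ⟨qb, hqb, hqb'⟩ := hL.exists_isMaxOn hLn (f := Prod.fst) (by fun_prop)
  replace hpa' : ∀ p ∈ K, pa.1 ≤ p.1 := fun p hp => hpa' hp
  replace hpb' : ∀ p ∈ K, p.1 ≤ pb.1 := fun p hp => hpb' hp
  replace hqa' : ∀ p ∈ L, qa.1 ≤ p.1 := fun p hp => hqa' hp
  replace hqb' : ∀ p ∈ L, p.1 ≤ qb.1 := fun p hp => hqb' hp
  set α := pa.1 + qa.1 with hα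
  set β := pb.1 + qb.1 with hβ
  have hαβ : α ≤ β := by linarith [hpa' _ hpb, hqa' _ hqb]
  have hex : ∀ τ ∈ Set.Icc α β, ∃ p ∈ K, ∃ q ∈ L, p.1 + q.1 = τ := by
    intro τ hτ
    have hc : Convex ℝ (Prod.fst '' (K + L)) :=
      (hKc.add hLc).linear_image (LinearMap.fst ℝ ℝ ℝ)
    have := hc.ordConnected.out (x := α) ⟨pa + qa, Set.add_mem_add hpa hqa, rfl⟩
      (y := β) ⟨pb + qb, Set.add_mem_add hpb hqb, rfl⟩ hτ
    obtain ⟨_, ⟨p, hp, q, hq, rfl⟩, h⟩ := this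
    exact ⟨p, hp, q, hq, h⟩
  have hopt := fun τ (hτ : τ ∈ Set.Icc α β) => exists_opt hK hL (hex τ hτ)
  choose! P Q hPQ hmin using hopt
  set c : ℝ → ℝ := fun τ => max α (min τ β) with hc
  have hcI : ∀ τ, c τ ∈ Set.Icc α β := fun τ =>
    ⟨le_max_left _ _, max_le hαβ (min_le_right _ _)⟩
  have hcα : c α = α := by simp [hc, hαβ]
  have hcβ : c β = β := by simp [hc, hαβ]
  have hcm : Monotone c := fun a b h => max_le_max le_rfl (min_le_min h le_rfl)
  have hcl : ∀ a b, a ≤ b → c b - c a ≤ b - a := by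
    intro a b h
    simp only [hc]
    rcases max_cases α (min a β) with h1 | h1 <;> rcases max_cases α (min b β) with h2 | h2 <;>
    rcases min_cases a β with h3 | h3 <;> rcases min_cases b β with h4 | h4 <;> linarith
  have hsum : ∀ τ, (P (c τ)).1 + (Q (c τ)).1 = c τ := fun τ => (hPQ _ (hcI τ)).2.2.1
  have hm : ∀ a b, a ≤ b → (P (c a)).1 ≤ (P (c b)).1 ∧ (Q (c a)).1 ≤ (Q (c b)).1 := by
    intro a b h
    rcases (hcm h).eq_or_lt with h | h
    · rw [h]; exact ⟨le_rfl, le_rfl⟩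
    · exact opt_mono hKc hLc h (hPQ _ (hcI a)) (hmin _ (hcI a)) (hPQ _ (hcI b)) (hmin _ (hcI b))
  have hPα := hPQ α ⟨le_rfl, hαβ⟩
  have hPβ := hPQ β ⟨hαβ, le_rfl⟩
  refine ⟨α, β, fun τ => P (c τ), fun τ => Q (c τ), hαβ, fun τ => ⟨c τ, hPQ _ (hcI τ)⟩,
    fun a b h => (hm a b h).1, fun a b h => (hm a b h).2, ?_, ?_, ?_, ?_⟩
  · refine LipschitzWith.of_le_add fun a b => ?_
    rw [Real.dist_eq]
    rcases le_total a b with h | h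
    · linarith [(hm a b h).1, abs_nonneg (a - b)]
    · linarith [(hm b a h).2, hsum a, hsum b, hcl b a h, le_abs_self (a - b)]
  · refine LipschitzWith.of_le_add fun a b => ?_
    rw [Real.dist_eq]
    rcases le_total a b with h | h
    · linarith [(hm a b h).2, abs_nonneg (a - b)]
    · linarith [(hm b a h).1, hsum a, hsum b, hcl b a h, le_abs_self (a - b)]
  · intro p hp
    simp only [hcα, hcβ]
    constructor
    · linarith [hPα.2.2.1, hqa' _ hPα.2.1, hpa' p hp]
    · linarith [hPβ.2.2.1, hqb' _ hPβ.2.1, hpb' p hp]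
  · intro q hq
    simp only [hcα, hcβ]
    constructor
    · linarith [hPα.2.2.1, hpa' _ hPα.1, hqa' q hq]
    · linarith [hPβ.2.2.1, hpb' _ hPβ.1, hqb' q hq]

lemma upper_quad {K L : Set (ℝ × ℝ)}
    (hKn : K.Nonempty) (hK : IsCompact K) (hKc : Convex ℝ K)
    (hLn : L.Nonempty) (hL : IsCompact L) (hLc : Convex ℝ L) :
    ∃ C₁ C₂ C₃ : ℝ, ∀ x y : ℝ, 0 ≤ x → 0 ≤ y →
      ∫ u in Prod.fst '' (x • K + y • L), topF (x • K + y • L) u =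
        C₁ * x ^ 2 + C₂ * x * y + C₃ * y ^ 2 := by
  obtain ⟨α, β, P, Q, hαβ, hopt, hPm, hQm, hPl, hQl, hPe, hQe⟩ :=
    exists_param hKn hK hKc hLn hL hLc
  set s : ℝ → ℝ := fun τ => (P τ).1 with hs
  set t : ℝ → ℝ := fun τ => (Q τ).1 with ht
  set D : Set ℝ := Set.Icc α β ∩ ({τ | DifferentiableAt ℝ s τ} ∩ {τ | DifferentiableAt ℝ t τ})
    with hD
  have hDm : MeasurableSet D := measurableSet_Icc.inter
    ((measurableSet_of_differentiableAt ℝ s).inter (measurableSet_of_differentiableAt ℝ t))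
  have hnull : volume (Set.Icc α β \ D) = 0 := by
    have h : ∀ᵐ τ, DifferentiableAt ℝ s τ ∧ DifferentiableAt ℝ t τ :=
      hPl.ae_differentiableAt.and hQl.ae_differentiableAt
    refine measure_mono_null ?_ (ae_iff.1 h)
    rintro τ ⟨h1, h2⟩ h3
    exact h2 ⟨h1, h3⟩
  have key : ∀ x y : ℝ, 0 ≤ x → 0 ≤ y →
      IntegrableOn (fun τ => (x * deriv s τ + y * deriv t τ) * (x * (P τ).2 + y * (Q τ).2)) D ∧
      ∫ u in Prod.fst '' (x • K + y • L), topF (x • K + y • L) u =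
        ∫ τ in D, (x * deriv s τ + y * deriv t τ) * (x * (P τ).2 + y * (Q τ).2) := by
    intro x y hx hy
    set M := x • K + y • L with hM
    have hMc : IsCompact M := comb_compact hK hL x y
    set φ : ℝ → ℝ := fun τ => x * s τ + y * t τ with hφ
    have hφm : Monotone φ := fun a b h =>
      add_le_add (mul_le_mul_of_nonneg_left (hPm h) hx) (mul_le_mul_of_nonneg_left (hQm h) hy)
    have hφd : ∀ τ ∈ D, HasDerivWithinAt φ (x * deriv s τ + y * deriv t τ) D τ := fun τ hτ =>
      ((hτ.2.1.hasDerivAt.const_mul x).add (hτ.2.2.hasDerivAt.const_mul y)).hasDerivWithinAt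
    have hφl : LipschitzWith (‖x‖₊ * 1 + ‖y‖₊ * 1) φ :=
      ((lipschitzWith_smul x).comp hPl).add ((lipschitzWith_smul y).comp hQl)
    have hmem : ∀ τ, (φ τ, x * (P τ).2 + y * (Q τ).2) ∈ M := by
      intro τ
      obtain ⟨τ', h⟩ := hopt τ
      exact Set.add_mem_add (Set.smul_mem_smul_set h.1) (Set.smul_mem_smul_set h.2.1)
    have htop : ∀ τ, topF M (φ τ) = x * (P τ).2 + y * (Q τ).2 := by
      intro τ
      refine topF_eq hMc (hmem τ) ?_
      rintro w ⟨_, ⟨p, hp, rfl⟩, _, ⟨q, hq, rfl⟩, h⟩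
      have h1 := congrArg Prod.fst h
      have h2 := congrArg Prod.snd h
      simp at h1 h2
      obtain ⟨τ', h⟩ := hopt τ
      rw [← h2]
      exact opt_scale hKc hLc h hx hy hp hq h1
    have himg : φ '' Set.Icc α β = Prod.fst '' M := by
      apply Set.Subset.antisymm
      · rintro _ ⟨τ, _, rfl⟩
        exact ⟨_, hmem τ, rfl⟩
      · rintro _ ⟨_, ⟨_, ⟨p, hp, rfl⟩, _, ⟨q, hq, rfl⟩, rfl⟩, rfl⟩
        refine intermediate_value_Icc hαβ hφl.continuous.continuousOn ⟨?_, ?_⟩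
        · exact add_le_add (mul_le_mul_of_nonneg_left (hPe p hp).1 hx)
            (mul_le_mul_of_nonneg_left (hQe q hq).1 hy)
        · exact add_le_add (mul_le_mul_of_nonneg_left (hPe p hp).2 hx)
            (mul_le_mul_of_nonneg_left (hQe q hq).2 hy)
    have hsub : φ '' D ⊆ Prod.fst '' M := himg ▸ Set.image_mono Set.inter_subset_left
    have hn2 : volume (φ '' (Set.Icc α β \ D)) = 0 := by
      have := hφl.hausdorffMeasure_image_le zero_le_one (Set.Icc α β \ D)
      rw [hausdorffMeasure_real, hnull, mul_zero] at this
      exact le_antisymm this bot_le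
    have hae : (Prod.fst '' M : Set ℝ) =ᵐ[volume] φ '' D := by
      refine Filter.EventuallyLE.antisymm ?_ hsub.eventuallyLE
      rw [ae_le_set]
      refine measure_mono_null ?_ hn2
      rw [← himg]
      rintro _ ⟨⟨τ, hτ, rfl⟩, h⟩
      exact ⟨τ, ⟨hτ, fun h' => h ⟨τ, h', rfl⟩⟩, rfl⟩
    have hint : IntegrableOn (topF M) (φ '' D) := (topF_integrable hMc).mono_set hsub
    rw [integrableOn_image_iff_integrableOn_deriv_smul_of_monotoneOn hDm hφd
      (hφm.monotoneOn D)] at hint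
    simp only [htop, smul_eq_mul] at hint
    refine ⟨hint, ?_⟩
    rw [setIntegral_congr_set hae, integral_image_eq_integral_deriv_smul_of_monotoneOn hDm hφd
      (hφm.monotoneOn D)]
    simp only [htop, smul_eq_mul]
  have i1 := (key 1 0 zero_le_one le_rfl).1
  have i3 := (key 0 1 le_rfl zero_le_one).1
  have i2 := (((key 1 1 zero_le_one zero_le_one).1).sub i1).sub i3
  have j1 : IntegrableOn (fun τ => deriv s τ * (P τ).2) D := by simpa using i1
  have j3 : IntegrableOn (fun τ => deriv t τ * (Q τ).2) D := by simpa using i3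
  have j2 : IntegrableOn (fun τ => deriv s τ * (Q τ).2 + deriv t τ * (P τ).2) D := by
    refine Integrable.congr i2 (Filter.Eventually.of_forall fun τ => ?_)
    simp only [Pi.sub_apply]
    ring
  refine ⟨∫ τ in D, deriv s τ * (P τ).2, ∫ τ in D, (deriv s τ * (Q τ).2 + deriv t τ * (P τ).2),
    ∫ τ in D, deriv t τ * (Q τ).2, fun x y hx hy => ?_⟩
  have h : ∀ τ, (x * deriv s τ + y * deriv t τ) * (x * (P τ).2 + y * (Q τ).2) =
      (deriv s τ * (P τ).2 * x ^ 2 + (deriv s τ * (Q τ).2 + deriv t τ * (P τ).2) * (x * y)) +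
        deriv t τ * (Q τ).2 * y ^ 2 := fun τ => by ring
  have j12 : IntegrableOn (fun τ => deriv s τ * (P τ).2 * x ^ 2 +
      (deriv s τ * (Q τ).2 + deriv t τ * (P τ).2) * (x * y)) D :=
    (j1.mul_const (x ^ 2)).add (j2.mul_const (x * y))
  rw [(key x y hx hy).2, mul_assoc, integral_congr_ae (Filter.Eventually.of_forall h),
    integral_add j12 (j3.mul_const (y ^ 2)),
    integral_add (j1.mul_const (x ^ 2)) (j2.mul_const (x * y)),
    integral_mul_const, integral_mul_const, integral_mul_const]

/-- For convex bodies `K, L ⊂ ℝ²` and `x, y ≥ 0`,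
`vol₂(xK + yL) = vol₂(K) x² + 2 v(K,L) x y + vol₂(L) y²`, where
`v(K,L) = (vol₂(K+L) - vol₂(K) - vol₂(L))/2`. -/
theorem stmt_19 (K L : Set (ℝ × ℝ))
    (hK : K.Nonempty) (hK' : IsCompact K) (hK'' : Convex ℝ K)
    (hL : L.Nonempty) (hL' : IsCompact L) (hL'' : Convex ℝ L)
    (x y : ℝ) (hx : 0 ≤ x) (hy : 0 ≤ y) :
    (volume (x • K + y • L)).toReal =
      (volume K).toReal * x ^ 2 +
        2 * (((volume (K + L)).toReal - (volume K).toReal - (volume L).toReal) / 2)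
          * x * y +
        (volume L).toReal * y ^ 2 := by
  have hrn : ∀ {M : Set (ℝ × ℝ)}, M.Nonempty → (reflV M).Nonempty := by
    intro M h
    rw [← Set.image_nonempty (f := Prod.fst), reflV_fst]
    exact h.image _
  obtain ⟨A₁, A₂, A₃, hA⟩ := upper_quad hK hK' hK'' hL hL' hL''
  obtain ⟨B₁, B₂, B₃, hB⟩ := upper_quad (hrn hK) (reflV_compact hK') (reflV_convex hK'')
    (hrn hL) (reflV_compact hL') (reflV_convex hL'')
  have key : ∀ x y : ℝ, 0 ≤ x → 0 ≤ y → (volume (x • K + y • L)).toReal =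
      (A₁ + B₁) * x ^ 2 + (A₂ + B₂) * x * y + (A₃ + B₃) * y ^ 2 := by
    intro x y hx hy
    rw [vol_eq (comb_compact hK' hL' x y) ((hK''.smul x).add (hL''.smul y)), reflV_comb,
      hA x y hx hy, hB x y hx hy]
    ring
  have k1 := key 1 0 zero_le_one le_rfl
  have k2 := key 0 1 le_rfl zero_le_one
  have k3 := key 1 1 zero_le_one zero_le_one
  rw [Set.zero_smul_set hL, one_smul, add_zero] at k1
  rw [Set.zero_smul_set hK, one_smul, zero_add] at k2
  rw [one_smul, one_smul] at k3
  rw [key x y hx hy, k1, k2, k3]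
  ring
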